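/- arXiv:math/0503595 — 2 statements merged into one kernel-verified Lean document; each statement's English description precedes it below -/
import Mathlib

section
/- Let b ∈ L¹(0,∞), μ ∈ ℂ, and let f : ℝ → ℂ be a continuous 2π-periodic function satisfying f(t) = μ ∫₀^∞ b(s) f(t-s) ds for every t ∈ ℝ. If 1 - μ b̃(ik) ≠ 0 for every k ∈ ℤ, where b̃(λ) = ∫₀^∞ e^{-λt} b(t) dt is the Laplace transform of b, then f is identically zero. -/
open MeasureTheory Real

/-- The character `t ↦ e^{-ikt}` is `2π`-periodic for every integer `k`. -/
lemma periodic_exp_neg_I_int_mul (k : ℤ) :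
    Function.Periodic (fun t : ℝ => Complex.exp (-(Complex.I * k) * t)) (2 * π) := by
  intro t
  refine Complex.exp_eq_exp_iff_exists_int.2 ⟨-k, ?_⟩
  push_cast
  ring

/-- A continuous `2π`-periodic function all of whose Fourier modes vanish is zero. -/
lemma Function.Periodic.eq_zero_of_forall_integral_exp_mul_eq_zero {f : ℝ → ℂ}
    (hf_per : Function.Periodic f (2 * π)) (hf_cont : Continuous f)
    (h : ∀ k : ℤ, ∫ t in (0 : ℝ)..2 * π, Complex.exp (-(Complex.I * k) * t) * f t = 0)
    (t : ℝ) : f t = 0 := by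
  have : Fact (0 < 2 * π) := ⟨two_pi_pos⟩
  let F : C(AddCircle (2 * π), ℂ) := ⟨hf_per.lift, continuous_coinduced_dom.2 hf_cont⟩
  have hF (x : ℝ) : F (x : AddCircle (2 * π)) = f x := hf_per.lift_coe x
  have hcoeff : fourierCoeff F = 0 := by
    ext k
    rw [fourierCoeff_eq_intervalIntegral _ k 0, zero_add, Pi.zero_apply]
    refine smul_eq_zero_of_right _ ((intervalIntegral.integral_congr fun x _ => ?_).trans (h k))
    have hpi : (π : ℂ) ≠ 0 := by exact_mod_cast pi_ne_zero
    simp only [hF, fourier_coe_apply, smul_eq_mul]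
    congr 2
    push_cast
    field_simp
  have hsum := has_pointwise_sum_fourier_series_of_summable (f := F)
    (hcoeff ▸ summable_zero) (t : AddCircle (2 * π))
  simp only [hcoeff, Pi.zero_apply, zero_smul, hF] at hsum
  exact hsum.unique hasSum_zero

/-- Translating a `2π`-periodic function by `s` multiplies its `k`-th Fourier mode by
`e^{-iks}`. -/
lemma Function.Periodic.integral_exp_mul_comp_sub {f : ℝ → ℂ}
    (hf_per : Function.Periodic f (2 * π)) (k : ℤ) (s : ℝ) :
    ∫ t in (0 : ℝ)..2 * π, Complex.exp (-(Complex.I * k) * t) * f (t - s) =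
      Complex.exp (-(Complex.I * k) * s) *
        ∫ t in (0 : ℝ)..2 * π, Complex.exp (-(Complex.I * k) * t) * f t := by
  have hper : Function.Periodic (fun t : ℝ => Complex.exp (-(Complex.I * k) * t) * f t)
      (2 * π) := (periodic_exp_neg_I_int_mul k).mul hf_per
  have hsplit (t : ℝ) : Complex.exp (-(Complex.I * k) * t) * f (t - s) =
      Complex.exp (-(Complex.I * k) * s) *
        (Complex.exp (-(Complex.I * k) * (t - s : ℝ)) * f (t - s)) := by
    rw [← mul_assoc, ← Complex.exp_add]
    congr 2
    push_cast
    ring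
  simp_rw [hsplit]
  rw [intervalIntegral.integral_const_mul, intervalIntegral.integral_comp_sub_right
    (fun t : ℝ => Complex.exp (-(Complex.I * k) * t) * f t)]
  congr 1
  have := hper.intervalIntegral_add_eq (0 - s) 0
  rwa [zero_add, show 0 - s + 2 * π = 2 * π - s by ring] at this

/-- The `k`-th Fourier mode of the convolution of `b ∈ L¹(0,∞)` with a continuous `2π`-periodic
function is the product of the Laplace transform of `b` at `ik` and the `k`-th Fourier mode. -/
lemma Function.Periodic.integral_exp_mul_integral_Ioi_mul_comp_sub {b f : ℝ → ℂ}
    (hb : IntegrableOn b (Set.Ioi 0))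
    (hf_per : Function.Periodic f (2 * π)) (hf_cont : Continuous f) (k : ℤ) :
    ∫ t in (0 : ℝ)..2 * π, Complex.exp (-(Complex.I * k) * t) *
        ∫ s in Set.Ioi (0 : ℝ), b s * f (t - s) =
      (∫ t in Set.Ioi (0 : ℝ), Complex.exp (-(Complex.I * k) * t) * b t) *
        ∫ t in (0 : ℝ)..2 * π, Complex.exp (-(Complex.I * k) * t) * f t := by
  obtain ⟨C, hC⟩ := (hf_per.isBounded_of_continuous two_pi_pos.ne' hf_cont).exists_norm_le
  have hint : Integrable
      (Function.uncurry fun t s : ℝ => Complex.exp (-(Complex.I * k) * t) * (b s * f (t - s)))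
      ((volume.restrict (Set.uIoc 0 (2 * π))).prod (volume.restrict (Set.Ioi 0))) := by
    have : IsFiniteMeasure (volume.restrict (Set.uIoc 0 (2 * π))) :=
      ⟨by simp [Set.uIoc]⟩
    have hbp : Integrable (fun z : ℝ × ℝ => b z.2)
        ((volume.restrict (Set.uIoc 0 (2 * π))).prod (volume.restrict (Set.Ioi 0))) :=
      Integrable.comp_snd hb _
    have hmeas : Continuous fun z : ℝ × ℝ =>
        Complex.exp (-(Complex.I * k) * z.1) * f (z.1 - z.2) := by fun_prop
    refine (hbp.bdd_mul (c := C) hmeas.aestronglyMeasurable (ae_of_all _ fun z => ?_)).congr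
      (ae_of_all _ fun z => ?_)
    · rw [norm_mul, Complex.norm_exp]
      simpa using hC _ (Set.mem_range_self (z.1 - z.2))
    · simp only [Function.uncurry]
      ring
  simp_rw [← integral_const_mul]
  rw [intervalIntegral_integral_swap hint, ← integral_mul_const]
  refine integral_congr_ae (ae_of_all _ fun s => ?_)
  simp only [mul_left_comm _ (b s), intervalIntegral.integral_const_mul,
    hf_per.integral_exp_mul_comp_sub k s]
  ring

/-- Uniqueness: if a continuous `2π`-periodic `f` satisfies the homogeneous equation
`f(t) = μ ∫₀^∞ b(s) f(t-s) ds` and `1 - μ b̃(ik) ≠ 0` for all `k ∈ ℤ`, then `f ≡ 0`. -/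
theorem homogeneous_periodic_solution_zero (b : ℝ → ℂ) (μ : ℂ)
    (hb : IntegrableOn b (Set.Ioi 0))
    (f : ℝ → ℂ) (hf_cont : Continuous f) (hf_per : Function.Periodic f (2 * π))
    (hf_eq : ∀ t : ℝ, f t = μ * ∫ s in Set.Ioi (0:ℝ), b s * f (t - s))
    (hspec : ∀ k : ℤ,
      1 - μ * ∫ t in Set.Ioi (0:ℝ), Complex.exp (-(Complex.I * k) * t) * b t ≠ 0) :
    ∀ t : ℝ, f t = 0 := by
  refine hf_per.eq_zero_of_forall_integral_exp_mul_eq_zero hf_cont fun k => ?_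
  have hmode := hf_per.integral_exp_mul_integral_Ioi_mul_comp_sub hb hf_cont k
  refine (mul_eq_zero.1 ?_).resolve_left (hspec k)
  rw [sub_mul, one_mul, mul_assoc, ← hmode, ← intervalIntegral.integral_const_mul, sub_eq_zero]
  refine intervalIntegral.integral_congr fun t _ => ?_
  rw [mul_left_comm, ← hf_eq t]
end

section
/- Let d ≥ 1 be an integer and let x ∈ ℝ^d be such that x + 2πn ≠ 0 for every n ∈ ℤ^d. Then the sum G_d(x) = ∑_{n ∈ ℤ^d} ∫₀^∞ (4πt)^{-d/2} e^{-t} e^{-|x+2πn|²/t} dt is finite; that is, each integral is finite and the series over n ∈ ℤ^d converges. -/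
open MeasureTheory Real

/-- Translates of the integer lattice in `ℝ^d` have summable inverse powers of exponent `> d`. -/
theorem summable_inv_norm_intCast_sub_pow {d k : ℕ} (hk : d < k) (w : Fin d → ℝ) :
    Summable fun n : Fin d → ℤ => ‖(fun i => (n i : ℝ)) - w‖⁻¹ ^ k := by
  let b := (Pi.basisFun ℝ (Fin d)).restrictScalars ℤ
  have hrank : Module.finrank ℤ (Submodule.span ℤ (Set.range (Pi.basisFun ℝ (Fin d)))) = d := by
    simpa using Module.finrank_eq_card_basis b
  have h := ZLattice.summable_norm_sub_inv_pow
    (Submodule.span ℤ (Set.range (Pi.basisFun ℝ (Fin d)))) k (by rwa [hrank]) w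
  refine (b.equivFun.symm.toEquiv.summable_iff.mpr h).congr fun n => ?_
  have hn : ((b.equivFun.symm n : Submodule.span ℤ (Set.range (Pi.basisFun ℝ (Fin d)))) :
      Fin d → ℝ) = fun i => (n i : ℝ) := by
    ext i
    simp [b, Module.Basis.equivFun_symm_apply, Finset.sum_apply, Pi.single_apply]
  simp only [Function.comp_apply, LinearEquiv.coe_toEquiv, hn]

theorem exp_neg_div_le_factorial_mul {A t : ℝ} (hA : 0 < A) (ht : 0 < t) (d : ℕ) :
    exp (-A / t) ≤ d.factorial * A⁻¹ ^ d * t ^ d := by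
  have h := pow_div_factorial_le_exp (A / t) (by positivity) d
  have hpos : 0 < (A / t) ^ d / d.factorial := by positivity
  calc exp (-A / t) = (exp (A / t))⁻¹ := by rw [neg_div, exp_neg]
    _ ≤ ((A / t) ^ d / d.factorial)⁻¹ := inv_anti₀ hpos h
    _ = d.factorial * A⁻¹ ^ d * t ^ d := by
        rw [inv_div, div_pow, inv_pow]
        field_simp

/-- A heat-kernel-type integrand is dominated by a Gamma integrand, with polynomial decay in the
squared distance `A`. -/
theorem heat_integrand_le {A t : ℝ} (hA : 0 < A) (ht : 0 < t) (d : ℕ) :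
    (4 * π * t) ^ (-(d : ℝ) / 2) * exp (-t) * exp (-A / t) ≤
      (4 * π) ^ (-(d : ℝ) / 2) * d.factorial * A⁻¹ ^ d *
        (exp (-t) * t ^ ((d : ℝ) / 2 + 1 - 1)) := by
  have hpow : t ^ (-(d : ℝ) / 2) * t ^ d = t ^ ((d : ℝ) / 2 + 1 - 1) := by
    rw [← rpow_natCast t d, ← rpow_add ht]
    congr 1
    ring
  calc _ ≤ (4 * π * t) ^ (-(d : ℝ) / 2) * exp (-t) * (d.factorial * A⁻¹ ^ d * t ^ d) := by
        gcongr
        exact exp_neg_div_le_factorial_mul hA ht d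
    _ = _ := by
        rw [mul_rpow (by positivity) ht.le, ← hpow]
        ring

theorem integrableOn_heat_integrand {A : ℝ} (hA : 0 < A) (d : ℕ) :
    IntegrableOn (fun t : ℝ => (4 * π * t) ^ (-(d : ℝ) / 2) * exp (-t) * exp (-A / t))
      (Set.Ioi 0) := by
  refine Integrable.mono' ((GammaIntegral_convergent (s := (d : ℝ) / 2 + 1)
    (by positivity)).const_mul ((4 * π) ^ (-(d : ℝ) / 2) * d.factorial * A⁻¹ ^ d)) ?_ ?_
  · exact Measurable.aestronglyMeasurable (by fun_prop)
  · filter_upwards [ae_restrict_mem measurableSet_Ioi] with t ht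
    have ht' : 0 < t := ht
    rw [norm_of_nonneg (by positivity)]
    exact heat_integrand_le hA ht' d

theorem integral_heat_integrand_le {A : ℝ} (hA : 0 < A) (d : ℕ) :
    ∫ t in Set.Ioi (0 : ℝ), (4 * π * t) ^ (-(d : ℝ) / 2) * exp (-t) * exp (-A / t) ≤
      (4 * π) ^ (-(d : ℝ) / 2) * d.factorial * Gamma ((d : ℝ) / 2 + 1) * A⁻¹ ^ d := by
  calc _ ≤ ∫ t in Set.Ioi (0 : ℝ), (4 * π) ^ (-(d : ℝ) / 2) * d.factorial * A⁻¹ ^ d *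
        (exp (-t) * t ^ ((d : ℝ) / 2 + 1 - 1)) :=
        setIntegral_mono_on (integrableOn_heat_integrand hA d)
          ((GammaIntegral_convergent (by positivity)).const_mul _) measurableSet_Ioi
          fun t ht => heat_integrand_le hA ht d
    _ = _ := by
        rw [integral_const_mul, ← Gamma_eq_integral (by positivity)]
        ring

theorem sq_norm_le_sum_sq {ι : Type*} [Fintype ι] (y : ι → ℝ) : ‖y‖ ^ 2 ≤ ∑ i, y i ^ 2 := by
  have hS : 0 ≤ ∑ i, y i ^ 2 := Finset.sum_nonneg fun i _ => sq_nonneg _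
  refine (le_sqrt (norm_nonneg y) hS).mp
    ((pi_norm_le_iff_of_nonneg (sqrt_nonneg _)).mpr fun i => ?_)
  rw [norm_eq_abs]
  exact abs_le_sqrt (Finset.single_le_sum (f := fun i => y i ^ 2) (fun j _ => sq_nonneg _)
    (Finset.mem_univ i))

/-- For `x ∈ ℝ^d` avoiding the lattice `2πℤ^d`, the quantity
`G_d(x) = ∑_{n ∈ ℤ^d} ∫₀^∞ (4πt)^{-d/2} e^{-t} e^{-|x+2πn|²/t} dt` is finite:
each integral is finite and the series converges. -/
theorem Gd_finite (d : ℕ) (hd : 1 ≤ d) (x : Fin d → ℝ)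
    (hx : ∀ n : Fin d → ℤ, ∃ i, x i + 2 * π * n i ≠ 0) :
    (∀ n : Fin d → ℤ,
      IntegrableOn (fun t : ℝ =>
        (4 * π * t) ^ (-(d : ℝ) / 2) * Real.exp (-t) *
          Real.exp (-(∑ i, (x i + 2 * π * n i) ^ 2) / t)) (Set.Ioi 0)) ∧
    Summable (fun n : Fin d → ℤ =>
      ∫ t in Set.Ioi (0:ℝ),
        (4 * π * t) ^ (-(d : ℝ) / 2) * Real.exp (-t) *
          Real.exp (-(∑ i, (x i + 2 * π * n i) ^ 2) / t)) := by
  have hA (n : Fin d → ℤ) : 0 < ∑ i, (x i + 2 * π * n i) ^ 2 := by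
    obtain ⟨i, hi⟩ := hx n
    exact Finset.sum_pos' (fun j _ => sq_nonneg _) ⟨i, Finset.mem_univ i, by positivity⟩
  refine ⟨fun n => integrableOn_heat_integrand (hA n) d, ?_⟩
  have hdecay : Summable fun n : Fin d → ℤ => (∑ i, (x i + 2 * π * n i) ^ 2)⁻¹ ^ d := by
    refine Summable.of_nonneg_of_le (fun n => by have := hA n; positivity) (fun n => ?_)
      ((summable_inv_norm_intCast_sub_pow (k := 2 * d) (by omega)
        (-(2 * π)⁻¹ • x)).mul_left (((2 * π)⁻¹) ^ (2 * d)))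
    have hy : (fun i => x i + 2 * π * n i) =
        (2 * π) • ((fun i => (n i : ℝ)) - -(2 * π)⁻¹ • x) := by
      ext i
      simp only [Pi.smul_apply, Pi.sub_apply, smul_eq_mul]
      field_simp
      ring
    have hpos : 0 < ‖fun i => x i + 2 * π * n i‖ := by
      obtain ⟨i, hi⟩ := hx n
      exact norm_pos_iff.mpr fun h => hi (congrFun h i)
    calc (∑ i, (x i + 2 * π * n i) ^ 2)⁻¹ ^ d
        ≤ (‖fun i => x i + 2 * π * n i‖ ^ 2)⁻¹ ^ d := by
          have := hA n
          gcongr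
          exact sq_norm_le_sum_sq _
      _ = _ := by
          rw [hy, norm_smul, norm_of_nonneg (by positivity : 0 ≤ 2 * π), ← mul_pow, ← mul_inv]
          simp only [pow_mul, inv_pow]
  refine Summable.of_nonneg_of_le (fun n => ?_) (fun n => integral_heat_integrand_le (hA n) d)
    (hdecay.mul_left _)
  refine setIntegral_nonneg measurableSet_Ioi fun t ht => ?_
  have ht' : 0 < t := ht
  positivity
end
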